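/- For every finite open cover W of the decomposition space D, there exist a finite nonempty subtree X of T containing the identity e and a finite open cover {U_C} of D indexed by the connected components C of T ∖ X such that: (1) q(∂C) ⊆ U_C for every component C; (2) for distinct components C and C′, U_C ∩ U_{C′} ≠ ∅ if and only if some line in L has one endpoint in ∂C and the other endpoint in ∂C′; (3) U_C ∩ U_{C′} ∩ U_{C″} = ∅ for any pairwise distinct components C, C′, C″; and (4) every U_C is contained in some member of W. -/

import Mathlib

open scoped BigOperators

namespace DecompPaper

variable (B : Type) [DecidableEq B]

/-- The set of letters `B ⊔ B⁻¹` carries the discrete topology. -/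
instance : TopologicalSpace (B × Bool) := ⊥

/-- The Gromov boundary `∂F` of the free group on `B`: the space of infinite reduced
words, i.e. sequences of letters with no cancelling adjacent pair, topologized as a
subspace of the product of discrete spaces. -/
abbrev Boundary : Type :=
  {s : ℕ → B × Bool // ∀ k, s (k + 1) ≠ ((s k).1, !(s k).2)}

/-- The prefix of length `m` of an infinite reduced word, as an element of the free group. -/
def prefixOf (ξ : Boundary B) (m : ℕ) : FreeGroup B :=
  FreeGroup.mk (List.ofFn fun i : Fin m => ξ.1 i)

/-- Adjacency in the Cayley graph `T` of the free group with respect to `B`. -/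
def Adj (g h : FreeGroup B) : Prop :=
  ∃ x : B × Bool, h = g * FreeGroup.mk [x]

/-- A set of vertices of `T` is a subtree iff any two of its vertices are joined by a
path in the Cayley graph staying inside the set. -/
def IsSubtree (X : Set (FreeGroup B)) : Prop :=
  ∀ g ∈ X, ∀ h ∈ X, Relation.ReflTransGen (fun a b => Adj B a b ∧ b ∈ X) g h

/-- `C` is a connected component of `T ∖ X`. -/
def IsComponentOf (X C : Set (FreeGroup B)) : Prop :=
  ∃ v, v ∉ X ∧
    C = {u | Relation.ReflTransGen (fun a b => Adj B a b ∧ a ∉ X ∧ b ∉ X) v u}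

/-- `∂C`: the set of boundary points all of whose sufficiently long prefixes lie in `C`. -/
def boundaryOf (C : Set (FreeGroup B)) : Set (Boundary B) :=
  {ξ | ∃ m, ∀ k, m ≤ k → prefixOf B ξ k ∈ C}

/-- The sequence `a` of group elements converges to the boundary point `ξ`:
every prefix of `ξ` is eventually an initial segment of the reduced word of `a k`. -/
def TendstoBoundary (a : ℕ → FreeGroup B) (ξ : Boundary B) : Prop :=
  ∀ m : ℕ, ∃ K, ∀ k, K ≤ k → (List.ofFn fun i : Fin m => ξ.1 i) <+: (a k).toWord

/-- `{ξ, η}` is a line of the line pattern generated by the words `w i`: for some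
`g` and `i`, `ξ` and `η` are the limits of `g * (w i) ^ k` as `k → +∞` and `k → -∞`
(in one of the two orders). -/
def IsLine {r : ℕ} (w : Fin r → FreeGroup B) (ξ η : Boundary B) : Prop :=
  ∃ (g : FreeGroup B) (i : Fin r),
    (TendstoBoundary B (fun k => g * w i ^ k) ξ ∧
       TendstoBoundary B (fun k => g * (w i)⁻¹ ^ k) η) ∨
    (TendstoBoundary B (fun k => g * w i ^ k) η ∧
       TendstoBoundary B (fun k => g * (w i)⁻¹ ^ k) ξ)

/-- Malnormality of the family of cyclic subgroups `⟨w i⟩`. -/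
def Malnormal {r : ℕ} (w : Fin r → FreeGroup B) : Prop :=
  ∀ (g : FreeGroup B) (i j : Fin r),
    (∃ x : FreeGroup B, x ∈ Subgroup.zpowers (w i) ∧ x ≠ 1 ∧
        g * x * g⁻¹ ∈ Subgroup.zpowers (w j)) →
      i = j ∧ g ∈ Subgroup.zpowers (w i)

/-- The decomposition space `D`: the quotient of `∂F` by the smallest equivalence
relation identifying the two endpoints of each line, with the quotient topology. -/
abbrev DSpace {r : ℕ} (w : Fin r → FreeGroup B) : Type :=
  Quot (IsLine B w)

/-- The quotient projection `q : ∂F → D`. -/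
def qmap {r : ℕ} (w : Fin r → FreeGroup B) : Boundary B → DSpace B w :=
  Quot.mk _

/-- The geodesic of the line with endpoints `ξ` and `η`: all prefixes of `ξ` or of `η`
of length at least the length of their longest common initial segment. -/
def lineGeodesic (ξ η : Boundary B) : Set (FreeGroup B) :=
  {g | ∃ k : ℕ, (g = prefixOf B ξ k ∨ g = prefixOf B η k) ∧ ∃ i ≤ k, ξ.1 i ≠ η.1 i}

/-- The line with endpoints `ξ, η` passes through the subtree `X`. -/
def PassesThrough (ξ η : Boundary B) (X : Set (FreeGroup B)) : Prop :=
  ∃ g ∈ X, g ∈ lineGeodesic B ξ η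

/-- A function `σ : D → ℤ` is supported on the subtree `X` if `σ ∘ q` is constant on
`∂C` for every connected component `C` of `T ∖ X`. -/
def SupportedOn {r : ℕ} (w : Fin r → FreeGroup B) (σ : DSpace B w → ℤ)
    (X : Set (FreeGroup B)) : Prop :=
  ∀ C : Set (FreeGroup B), IsComponentOf B X C →
    ∀ ξ, ξ ∈ boundaryOf B C → ∀ η, η ∈ boundaryOf B C →
      σ (qmap B w ξ) = σ (qmap B w η)

/-- Prepending a letter to an infinite reduced word, cancelling if necessary. -/
def consB (x : B × Bool) (ξ : Boundary B) : Boundary B :=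
  if h : ξ.1 0 = (x.1, !x.2) then
    ⟨fun k => ξ.1 (k + 1), fun k => ξ.2 (k + 1)⟩
  else
    ⟨fun k => Nat.rec x (fun j _ => ξ.1 j) k, by
      intro k
      cases k with
      | zero => exact h
      | succ j => exact ξ.2 j⟩

/-- The action of the free group on its boundary: left multiplication followed by
reduction. -/
def actB (g : FreeGroup B) (ξ : Boundary B) : Boundary B :=
  g.toWord.foldr (consB B) ξ

/-- The induced action of the free group on the decomposition space. -/
noncomputable def actD {r : ℕ} (w : Fin r → FreeGroup B) (g : FreeGroup B)
    (x : DSpace B w) : DSpace B w :=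
  qmap B w (actB B g (Quot.out x))

/-- The map `p : (ℤ[F])^k → C(D, ℤ)` of right `ℤ[F]`-modules determined by generators
`σ j`, where an element of the free module `(ℤ[F])^k` is recorded as a finitely
supported function `(Fin k × F) →₀ ℤ` and `e_j · g` is sent to `σ j · g`. -/
noncomputable def pMap {r : ℕ} (w : Fin r → FreeGroup B) {k : ℕ}
    (σ : Fin k → DSpace B w → ℤ) (x : (Fin k × FreeGroup B) →₀ ℤ) :
    DSpace B w → ℤ :=
  fun d => x.sum fun p n => n * σ p.1 (actD B w p.2 d)

/-- Right translation by `g` on the free module `(ℤ[F])^k`, sending `e_j · h` to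
`e_j · (h * g)`. -/
noncomputable def fsTranslate {k : ℕ} (y : (Fin k × FreeGroup B) →₀ ℤ)
    (g : FreeGroup B) : (Fin k × FreeGroup B) →₀ ℤ :=
  Finsupp.mapDomain (fun p => (p.1, p.2 * g)) y

/-- The convex hull of a set of vertices of `T`: the smallest subtree containing it. -/
def hull (S : Set (FreeGroup B)) : Set (FreeGroup B) :=
  ⋂₀ {Y : Set (FreeGroup B) | IsSubtree B Y ∧ S ⊆ Y}

/-- The support of an element of the free module `(ℤ[F])^k`, relative to supports
`X j` of the generators: the convex hull of the union of the sets `g⁻¹ • X j` over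
the pairs `(j, g)` appearing with nonzero coefficient. -/
def fsSupport {k : ℕ} (X : Fin k → Set (FreeGroup B))
    (x : (Fin k × FreeGroup B) →₀ ℤ) : Set (FreeGroup B) :=
  hull B (⋃ p ∈ x.support, (fun v => p.2⁻¹ * v) '' X p.1)

/-- Antisymmetry of a `1`-cochain on oriented lines. -/
def Antisym {r : ℕ} (w : Fin r → FreeGroup B)
    (f : Boundary B → Boundary B → ℤ) : Prop :=
  ∀ ξ η, IsLine B w ξ η → f η ξ = -f ξ η

/-- A `1`-cochain is supported on the subtree `X`: it vanishes on lines not passing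
through `X`, and depends only on the pair of components of `T ∖ X` containing the two
endpoints. -/
def SupportedOn1 {r : ℕ} (w : Fin r → FreeGroup B)
    (f : Boundary B → Boundary B → ℤ) (X : Set (FreeGroup B)) : Prop :=
  (∀ ξ η, IsLine B w ξ η → ¬PassesThrough B ξ η X → f ξ η = 0) ∧
  (∀ C C' : Set (FreeGroup B), IsComponentOf B X C → IsComponentOf B X C' → C ≠ C' →
    ∀ ξ ξ' η η', IsLine B w ξ η → IsLine B w ξ' η' →
      ξ ∈ boundaryOf B C → ξ' ∈ boundaryOf B C →
      η ∈ boundaryOf B C' → η' ∈ boundaryOf B C' →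
      f ξ η = f ξ' η')

/-- Membership in `C¹`: an antisymmetric integer-valued function on oriented lines
supported on at least one finite nonempty subtree of `T`. -/
def MemC1 {r : ℕ} (w : Fin r → FreeGroup B)
    (f : Boundary B → Boundary B → ℤ) : Prop :=
  Antisym B w f ∧
    ∃ X : Set (FreeGroup B), X.Finite ∧ X.Nonempty ∧ IsSubtree B X ∧
      SupportedOn1 B w f X

/-- The ball of radius `R` about a set `Y` of vertices of `T` (word metric). -/
def ballAbout (Y : Set (FreeGroup B)) (R : ℕ) : Set (FreeGroup B) :=
  {g | ∃ y ∈ Y, (y⁻¹ * g).toWord.length ≤ R}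

/-- The map `p : (ℤ[F])^k → C¹` of right `ℤ[F]`-modules determined by generators
`f j`, sending `e_j · g` to `f j · g`. -/
noncomputable def pC1 {k : ℕ} (f : Fin k → Boundary B → Boundary B → ℤ)
    (x : (Fin k × FreeGroup B) →₀ ℤ) : Boundary B → Boundary B → ℤ :=
  fun ξ η => x.sum fun p n => n * f p.1 (actB B p.2 ξ) (actB B p.2 η)

/-- `σ : ∂F → ℤ` is constant on `∂C` for every connected component `C` of `T ∖ X`. -/
def ConstOnComponents (X : Set (FreeGroup B)) (σ : Boundary B → ℤ) : Prop :=
  ∀ C : Set (FreeGroup B), IsComponentOf B X C →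
    ∀ ξ, ξ ∈ boundaryOf B C → ∀ η, η ∈ boundaryOf B C → σ ξ = σ η

/-- The shadow `S(g) ⊆ ∂F` of a nontrivial group element `g`: the boundary points
having the reduced word of `g` as an initial segment. -/
def shadow (g : FreeGroup B) : Set (Boundary B) :=
  {ξ | prefixOf B ξ g.toWord.length = g}

end DecompPaper

namespace DecompPaper

section Lines

variable {B : Type}

/-- The first `m` letters of an infinite reduced word. -/
def initialWord (ξ : Boundary B) (m : ℕ) : List (B × Bool) :=
  List.ofFn fun i : Fin m => ξ.1 i

@[simp]
theorem length_initialWord (ξ : Boundary B) (m : ℕ) : (initialWord ξ m).length = m := by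
  simp [initialWord]

theorem initialWord_eq_iff {ξ η : Boundary B} {m : ℕ} :
    initialWord ξ m = initialWord η m ↔ ∀ i < m, ξ.1 i = η.1 i := by
  simp only [initialWord, List.ofFn_inj, funext_iff, Fin.forall_iff]

theorem initialWord_succ (ξ : Boundary B) (m : ℕ) :
    initialWord ξ (m + 1) = initialWord ξ m ++ [ξ.1 m] := by
  rw [initialWord, List.ofFn_succ_last]
  rfl

theorem isReduced_initialWord (ξ : Boundary B) (m : ℕ) :
    FreeGroup.IsReduced (initialWord ξ m) := by
  rw [FreeGroup.IsReduced, List.isChain_iff_getElem]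
  intro i hi h
  simp only [initialWord, List.getElem_ofFn] at h ⊢
  by_contra hne
  refine ξ.2 i (Prod.ext h.symm ?_)
  cases h1 : (ξ.1 i).2 <;> cases h2 : (ξ.1 (i + 1)).2 <;> simp_all

theorem take_initialWord (ξ : Boundary B) {m k : ℕ} (h : m ≤ k) :
    (initialWord ξ k).take m = initialWord ξ m := by
  induction k, h using Nat.le_induction with
  | base => exact List.take_of_length_le (by simp)
  | succ k hk ih => rw [initialWord_succ, List.take_append_of_le_length (by simpa), ih]

variable [DecidableEq B]

/-- Right multiplication by a letter either appends it to the reduced word or removes the last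
letter of that word. -/
theorem toWord_mul_letter (g : FreeGroup B) (x : B × Bool) :
    (g * FreeGroup.mk [x]).toWord = g.toWord ++ [x] ∨
      g.toWord = (g * FreeGroup.mk [x]).toWord ++ [(x.1, !x.2)] := by
  have hg : FreeGroup.mk g.toWord = g := FreeGroup.mk_toWord
  have hred : FreeGroup.IsReduced g.toWord := FreeGroup.isReduced_toWord
  rcases List.eq_nil_or_concat' g.toWord with h | ⟨L, y, h⟩
  · left
    rw [FreeGroup.toWord_mul, h]
    simp
  · rw [h] at hred
    by_cases hy : y = (x.1, !x.2)
    · right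
      have hL : FreeGroup.IsReduced L := hred.infix ⟨[], [y], by simp⟩
      have hmul : g * FreeGroup.mk [x] = FreeGroup.mk L := by
        rw [← hg, h, ← FreeGroup.mul_mk, mul_assoc, FreeGroup.mul_mk, hy]
        have : FreeGroup.mk ([(x.1, !x.2)] ++ [x]) = 1 := by
          obtain ⟨a, b⟩ := x
          have := FreeGroup.Red.Step.not_rev (L₁ := []) (L₂ := []) (x := a) (b := b)
          exact Quot.sound this
        rw [this, mul_one]
      rw [hmul, FreeGroup.toWord_mk, hL.reduce_eq, h, hy]
    · left
      have hyx : FreeGroup.IsReduced ([y] ++ [x]) := by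
        simp only [List.cons_append, List.nil_append, FreeGroup.isReduced_cons_cons,
          FreeGroup.IsReduced.singleton, and_true]
        intro h1
        by_contra h2
        exact hy (Prod.ext h1 (by cases hy2 : y.2 <;> cases hx2 : x.2 <;> simp_all))
      have := FreeGroup.IsReduced.append_overlap hred hyx (by simp)
      rw [FreeGroup.toWord_mul, FreeGroup.toWord_mk, FreeGroup.reduce_singleton, h,
        this.reduce_eq]

/-- A vertex entered by a single edge into the set of elements beginning with `P` is `P`. -/
theorem toWord_eq_of_enters {P : List (B × Bool)} {g : FreeGroup B} {x : B × Bool}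
    (hg : ¬ P <+: g.toWord) (hgx : P <+: (g * FreeGroup.mk [x]).toWord) :
    (g * FreeGroup.mk [x]).toWord = P := by
  rcases toWord_mul_letter g x with h | h
  · rw [h] at hgx ⊢
    rcases List.prefix_concat_iff.1 hgx with h' | h'
    · exact h'.symm
    · exact absurd h' hg
  · exact absurd (hgx.trans ⟨_, h.symm⟩) hg

theorem norm_le_of_enters_list {P : List (B × Bool)} (L : List (B × Bool)) {a : FreeGroup B}
    (ha : ¬ P <+: a.toWord) (hL : P <+: (a * FreeGroup.mk L).toWord) :
    (a⁻¹ * FreeGroup.mk P).norm ≤ L.length := by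
  induction L generalizing a with
  | nil => exact absurd (by simpa [← FreeGroup.one_eq_mk] using hL) ha
  | cons x L ih =>
    by_cases hx : P <+: (a * FreeGroup.mk [x]).toWord
    · rw [← toWord_eq_of_enters ha hx, FreeGroup.mk_toWord, inv_mul_cancel_left]
      exact FreeGroup.norm_mk_le.trans (by simp)
    · have h := ih hx (by rwa [mul_assoc, FreeGroup.mul_mk])
      have h2 : a⁻¹ * FreeGroup.mk P =
          FreeGroup.mk [x] * ((a * FreeGroup.mk [x])⁻¹ * FreeGroup.mk P) := by group
      rw [h2]
      refine (FreeGroup.norm_mul_le _ _).trans ?_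
      have := FreeGroup.norm_mk_le (L₁ := [x])
      simp only [List.length_cons, List.length_nil] at this ⊢
      omega

/-- A geodesic entering the set of elements beginning with `P` passes through `P`. -/
theorem norm_le_of_enters {P : List (B × Bool)} {a b : FreeGroup B}
    (ha : ¬ P <+: a.toWord) (hb : P <+: b.toWord) :
    (a⁻¹ * FreeGroup.mk P).norm ≤ (a⁻¹ * b).norm :=
  norm_le_of_enters_list _ ha (by rwa [FreeGroup.mk_toWord, mul_inv_cancel_left])

/-- If the orbit of `a` under powers of `u` enters the set of elements beginning with `P`, then
it comes within distance `‖u‖` of `P`. -/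
theorem exists_pow_near {P : List (B × Bool)} {a u : FreeGroup B} (n : ℕ)
    (ha : ¬ P <+: a.toWord) (hn : P <+: (a * u ^ n).toWord) :
    ∃ k : ℕ, ((a * u ^ k)⁻¹ * FreeGroup.mk P).norm ≤ u.norm := by
  induction n with
  | zero => exact absurd (by simpa using hn) ha
  | succ n ih =>
    by_cases h : P <+: (a * u ^ n).toWord
    · exact ih h
    · refine ⟨n, (norm_le_of_enters h hn).trans (le_of_eq ?_)⟩
      congr 1
      group

theorem toWord_prefixOf (ξ : Boundary B) (m : ℕ) :
    (prefixOf B ξ m).toWord = initialWord ξ m := by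
  rw [prefixOf, FreeGroup.toWord_mk]
  exact (isReduced_initialWord ξ m).reduce_eq

theorem norm_mk_initialWord (ξ : Boundary B) (m : ℕ) :
    (FreeGroup.mk (initialWord ξ m)).norm = m := by
  rw [FreeGroup.norm, FreeGroup.toWord_mk, (isReduced_initialWord ξ m).reduce_eq,
    length_initialWord]

/-- The powers `g * u ^ k` converge to `ξ` as the integer `k` goes to `+∞`. -/
def RayTo (g u : FreeGroup B) (ξ : Boundary B) : Prop :=
  ∀ m : ℕ, ∃ K : ℤ, ∀ k, K ≤ k → initialWord ξ m <+: (g * u ^ k).toWord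

theorem rayTo_iff {g u : FreeGroup B} {ξ : Boundary B} :
    RayTo g u ξ ↔ TendstoBoundary B (fun k => g * u ^ k) ξ := by
  refine forall_congr' fun m => ⟨?_, ?_⟩
  · rintro ⟨K, hK⟩
    refine ⟨K.toNat, fun k hk => ?_⟩
    have := hK k (by omega)
    rwa [zpow_natCast] at this
  · rintro ⟨K, hK⟩
    refine ⟨K, fun k hk => ?_⟩
    lift k to ℕ using by omega
    rw [zpow_natCast]
    exact hK k (by omega)

theorem RayTo.translate {g u : FreeGroup B} {ξ : Boundary B} (h : RayTo g u ξ) (n : ℤ) :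
    RayTo (g * u ^ n) u ξ := by
  intro m
  obtain ⟨K, hK⟩ := h m
  refine ⟨K - n, fun k hk => ?_⟩
  rw [mul_assoc, ← zpow_add]
  exact hK _ (by omega)

theorem RayTo.unique {g u : FreeGroup B} {ξ η : Boundary B} (hξ : RayTo g u ξ)
    (hη : RayTo g u η) : ξ = η := by
  apply Subtype.ext
  funext i
  obtain ⟨K, hK⟩ := hξ (i + 1)
  obtain ⟨K', hK'⟩ := hη (i + 1)
  have h1 := hK (max K K') (le_max_left _ _)
  have h2 := hK' (max K K') (le_max_right _ _)
  have h := List.prefix_of_prefix_length_le h1 h2 (by simp)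
  exact initialWord_eq_iff.1 (h.eq_of_length (by simp)) i (by omega)

/-- The orbit of a ray stays close to the prefixes of its limit. -/
theorem RayTo.exists_near {g u : FreeGroup B} {ξ : Boundary B} (h : RayTo g u ξ) {m : ℕ}
    (hm : g.norm < m) :
    ∃ k : ℕ, ((g * u ^ k)⁻¹ * FreeGroup.mk (initialWord ξ m)).norm ≤ u.norm := by
  obtain ⟨K, hK⟩ := rayTo_iff.1 h m
  refine exists_pow_near K (fun hp => ?_) (hK K le_rfl)
  have := hp.length_le
  rw [length_initialWord] at this
  exact absurd this (not_le.2 hm)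

theorem isLine_iff {r : ℕ} {w : Fin r → FreeGroup B} {ξ η : Boundary B} :
    IsLine B w ξ η ↔ ∃ (g : FreeGroup B) (i : Fin r) (u : FreeGroup B),
      (u = w i ∨ u = (w i)⁻¹) ∧ RayTo g u ξ ∧ RayTo g u⁻¹ η := by
  simp only [IsLine, ← rayTo_iff]
  refine exists_congr fun g => exists_congr fun i => ⟨?_, ?_⟩
  · rintro (⟨h1, h2⟩ | ⟨h1, h2⟩)
    · exact ⟨_, Or.inl rfl, h1, h2⟩
    · exact ⟨_, Or.inr rfl, h2, by rwa [inv_inv]⟩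
  · rintro ⟨u, rfl | rfl, h1, h2⟩
    · exact Or.inl ⟨h1, h2⟩
    · exact Or.inr ⟨by rwa [inv_inv] at h2, h1⟩

theorem IsLine.symm {r : ℕ} {w : Fin r → FreeGroup B} {ξ η : Boundary B}
    (h : IsLine B w ξ η) : IsLine B w η ξ := by
  obtain ⟨g, i, h⟩ := h
  exact ⟨g, i, h.symm⟩

theorem finite_norm_le [Finite B] (R : ℕ) : {g : FreeGroup B | g.norm ≤ R}.Finite :=
  (List.finite_length_le (B × Bool) R).preimage FreeGroup.toWord_injective.injOn

/-- Two rays with the same limit have conjugate nontrivial powers of their directions. -/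
theorem RayTo.exists_conj_zpow_eq [Finite B] {g h u v : FreeGroup B} {ξ : Boundary B}
    (hg : RayTo g u ξ) (hh : RayTo h v ξ) :
    ∃ a b : ℤ, a ≠ 0 ∧ (h⁻¹ * g) * u ^ a * (h⁻¹ * g)⁻¹ = v ^ b := by
  set M := max g.norm h.norm + 1
  choose k hk using fun m : ℕ => hg.exists_near (m := m + M) (by omega)
  choose l hl using fun m : ℕ => hh.exists_near (m := m + M) (by omega)
  have hball : ∀ m, ((g * u ^ k m)⁻¹ * (h * v ^ l m)).norm ≤ u.norm + v.norm := by
    intro m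
    set P := FreeGroup.mk (initialWord ξ (m + M))
    have h2 : (g * u ^ k m)⁻¹ * (h * v ^ l m) =
      ((g * u ^ k m)⁻¹ * P) * ((h * v ^ l m)⁻¹ * P)⁻¹ := by group
    rw [h2]
    refine (FreeGroup.norm_mul_le _ _).trans (add_le_add (hk m) ?_)
    rw [FreeGroup.norm_inv_eq]
    exact hl m
  have : Finite {c : FreeGroup B | c.norm ≤ u.norm + v.norm} := finite_norm_le _
  obtain ⟨c, hc⟩ := Finite.exists_infinite_fiber
    (fun m : ℕ => (⟨_, hball m⟩ : {c : FreeGroup B | c.norm ≤ u.norm + v.norm}))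
  have hinf := Set.infinite_coe_iff.1 hc
  obtain ⟨m₁, hm₁⟩ := hinf.nonempty
  obtain ⟨m₂, hm₂, hlt⟩ := hinf.exists_gt ((g * u ^ k m₁).norm + u.norm)
  have hne : k m₂ ≠ k m₁ := by
    intro he
    have h1 := hk m₂
    rw [he] at h1
    have h2 := FreeGroup.norm_mul_le (g * u ^ k m₁)
      ((g * u ^ k m₁)⁻¹ * FreeGroup.mk (initialWord ξ (m₂ + M)))
    rw [mul_inv_cancel_left, norm_mk_initialWord] at h2
    omega
  have heq : (g * u ^ k m₁)⁻¹ * (h * v ^ l m₁) = (g * u ^ k m₂)⁻¹ * (h * v ^ l m₂) :=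
    congrArg Subtype.val (hm₁.trans hm₂.symm)
  refine ⟨(k m₂ : ℤ) - k m₁, (l m₂ : ℤ) - l m₁, by omega, ?_⟩
  rw [zpow_sub, zpow_sub, zpow_natCast, zpow_natCast, zpow_natCast, zpow_natCast]
  have e1 : h * v ^ l m₂ = (g * u ^ k m₂) * ((g * u ^ k m₁)⁻¹ * (h * v ^ l m₁)) := by
    rw [heq, mul_inv_cancel_left]
  have e2 : v ^ l m₂ = h⁻¹ * ((g * u ^ k m₂) * ((g * u ^ k m₁)⁻¹ * (h * v ^ l m₁))) := by
    rw [← e1, inv_mul_cancel_left]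
  rw [e2]
  group

/-- Each boundary point is an endpoint of at most one line. -/
theorem IsLine.right_unique [Finite B] {r : ℕ} {w : Fin r → FreeGroup B}
    (hw : ∀ i, w i ≠ 1) (hmal : Malnormal B w) {ξ η η' : Boundary B}
    (hη : IsLine B w ξ η) (hη' : IsLine B w ξ η') : η = η' := by
  obtain ⟨g, i, u, hu, hgξ, hgη⟩ := isLine_iff.1 hη
  obtain ⟨h, j, v, hv, hhξ, hhη⟩ := isLine_iff.1 hη'
  obtain ⟨a, b, ha, hab⟩ := hgξ.exists_conj_zpow_eq hhξ
  have hu1 : u ≠ 1 := by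
    rcases hu with rfl | rfl
    · exact hw i
    · exact inv_ne_one.2 (hw i)
  have hmem : ∀ {i : Fin r} {u : FreeGroup B}, (u = w i ∨ u = (w i)⁻¹) → ∀ n : ℤ,
      u ^ n ∈ Subgroup.zpowers (w i) := by
    rintro i u (rfl | rfl) n
    · exact Subgroup.zpow_mem_zpowers _ _
    · exact Subgroup.zpow_mem _ (Subgroup.inv_mem _ (Subgroup.mem_zpowers _)) _
  obtain ⟨rfl, n, hn⟩ := hmal (h⁻¹ * g) i j
    ⟨u ^ a, hmem hu a, by simp [hu1, ha], by rw [hab]; exact hmem hv b⟩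
  have hg : ∃ n : ℤ, g = h * v ^ n := by
    rcases hv with rfl | rfl
    · exact ⟨n, by simp only at hn; rw [hn]; group⟩
    · exact ⟨-n, by simp only at hn; rw [inv_zpow, zpow_neg, inv_inv, hn]; group⟩
  obtain ⟨n, rfl⟩ := hg
  have huv : u = v ∨ u = v⁻¹ := by
    rcases hu with rfl | rfl <;> rcases hv with rfl | rfl <;> simp
  rcases huv with rfl | rfl
  · have h1 := hhη.translate (-n)
    rw [inv_zpow, zpow_neg, inv_inv] at h1
    exact hgη.unique h1
  · rw [inv_inv] at hgη
    have h1 := hhη.translate (-n)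
    rw [inv_zpow, zpow_neg, inv_inv] at h1
    exact (hgη.unique (hhξ.translate n)).trans (hgξ.unique h1)

/-- Only finitely many lines have endpoints that already differ within the first `m` letters. -/
theorem finite_lines_separated [Finite B] {r : ℕ} (w : Fin r → FreeGroup B) (m : ℕ) :
    {p : Boundary B × Boundary B | IsLine B w p.1 p.2 ∧
      initialWord p.1 m ≠ initialWord p.2 m}.Finite := by
  have hsub : ∀ h u : FreeGroup B,
      {p : Boundary B × Boundary B | RayTo h u p.1 ∧ RayTo h u⁻¹ p.2}.Subsingleton :=
    fun h u p hp q hq => Prod.ext (hp.1.unique hq.1) (hp.2.unique hq.2)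
  refine (Set.finite_iUnion fun i : Fin r => (finite_norm_le (m + (w i).norm)).biUnion
    fun h _ => (hsub h (w i)).finite.union (hsub h (w i)⁻¹).finite).subset ?_
  rintro ⟨ξ, η⟩ ⟨hline, hne⟩
  obtain ⟨g, i, u, hu, hξ, hη⟩ := isLine_iff.1 hline
  obtain ⟨K, hK⟩ := hξ m
  obtain ⟨K', hK'⟩ := hη m
  have hstart : ¬ initialWord ξ m <+: (g * u ^ (-K')).toWord := by
    intro hp
    have h1 := hK' K' le_rfl
    rw [inv_zpow, ← zpow_neg] at h1
    exact hne ((List.prefix_of_prefix_length_le hp h1 (by simp)).eq_of_length (by simp))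
  have hend : initialWord ξ m <+: (g * u ^ (-K') * u ^ (K + K').toNat).toWord := by
    rw [mul_assoc, ← zpow_natCast, ← zpow_add]
    exact hK _ (by omega)
  obtain ⟨k, hk⟩ := exists_pow_near _ hstart hend
  have huw : u.norm = (w i).norm := by
    rcases hu with rfl | rfl
    · rfl
    · exact FreeGroup.norm_inv_eq
  have e : g * u ^ (-K') * u ^ k = g * u ^ (-K' + k) := by
    rw [mul_assoc, ← zpow_natCast, ← zpow_add]
  rw [e, huw] at hk
  have hball : (g * u ^ (-K' + k)).norm ≤ m + (w i).norm := by
    have h1 : g * u ^ (-K' + k) = FreeGroup.mk (initialWord ξ m) *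
        ((g * u ^ (-K' + k))⁻¹ * FreeGroup.mk (initialWord ξ m))⁻¹ := by group
    rw [h1]
    refine (FreeGroup.norm_mul_le _ _).trans ?_
    rw [norm_mk_initialWord, FreeGroup.norm_inv_eq]
    omega
  have hη2 := hη.translate (-(-K' + k))
  rw [inv_zpow, zpow_neg, inv_inv] at hη2
  refine Set.mem_iUnion.2 ⟨i, Set.mem_biUnion hball ?_⟩
  rcases hu with rfl | rfl
  · exact Or.inl ⟨hξ.translate _, hη2⟩
  · exact Or.inr ⟨hξ.translate _, hη2⟩

end Lines

section Tree

variable {B : Type}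

theorem Adj.symm {g h : FreeGroup B} (hgh : Adj B g h) : Adj B h g := by
  obtain ⟨x, rfl⟩ := hgh
  refine ⟨(x.1, !x.2), ?_⟩
  have : (FreeGroup.mk [x])⁻¹ = FreeGroup.mk [(x.1, !x.2)] := by
    simp [FreeGroup.inv_mk, FreeGroup.invRev]
  rw [← this, mul_inv_cancel_right]

/-- Distinct components of the complement of `X` are disjoint. -/
theorem IsComponentOf.eq_of_mem {X C C' : Set (FreeGroup B)} (hC : IsComponentOf B X C)
    (hC' : IsComponentOf B X C') {g : FreeGroup B} (h : g ∈ C) (h' : g ∈ C') : C = C' := by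
  obtain ⟨v, -, rfl⟩ := hC
  obtain ⟨v', -, rfl⟩ := hC'
  have hsymm : Std.Symm (fun a b : FreeGroup B => Adj B a b ∧ a ∉ X ∧ b ∉ X) :=
    ⟨fun _ _ hab => ⟨hab.1.symm, hab.2.2, hab.2.1⟩⟩
  ext u
  exact ⟨fun hu => (h'.trans (Relation.ReflTransGen.stdSymm.symm _ _ h)).trans hu,
    fun hu => (h.trans (Relation.ReflTransGen.stdSymm.symm _ _ h')).trans hu⟩

theorem eq_of_mem_boundaryOf {X C C' : Set (FreeGroup B)} (hC : IsComponentOf B X C)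
    (hC' : IsComponentOf B X C') {ξ : Boundary B} (h : ξ ∈ boundaryOf B C)
    (h' : ξ ∈ boundaryOf B C') : C = C' := by
  obtain ⟨m, hm⟩ := h
  obtain ⟨m', hm'⟩ := h'
  exact hC.eq_of_mem hC' (hm (max m m') (le_max_left _ _)) (hm' (max m m') (le_max_right _ _))

variable [DecidableEq B]

/-- The ball of radius `N` about the identity is a subtree. -/
theorem isSubtree_ball (N : ℕ) : IsSubtree B {g : FreeGroup B | g.norm ≤ N} := by
  have key : ∀ L : List (B × Bool), FreeGroup.IsReduced L → L.length ≤ N →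
      Relation.ReflTransGen (fun a b => Adj B a b ∧ b ∈ {g : FreeGroup B | g.norm ≤ N})
        1 (FreeGroup.mk L) ∧
      Relation.ReflTransGen (fun a b => Adj B a b ∧ b ∈ {g : FreeGroup B | g.norm ≤ N})
        (FreeGroup.mk L) 1 := by
    intro L
    induction L using List.reverseRecOn with
    | nil => exact fun _ _ => ⟨.refl, .refl⟩
    | append_singleton L x ih =>
      intro hred hlen
      have hlen' : L.length ≤ N := by simp at hlen; omega
      obtain ⟨h1, h2⟩ := ih (hred.infix ⟨[], [x], by simp⟩) hlen'
      have hadj : Adj B (FreeGroup.mk L) (FreeGroup.mk (L ++ [x])) := ⟨x, by simp⟩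
      exact ⟨h1.tail ⟨hadj, FreeGroup.norm_mk_le.trans hlen⟩,
        h2.head ⟨hadj.symm, FreeGroup.norm_mk_le.trans hlen'⟩⟩
  intro g hg h hh
  have h1 := (key g.toWord FreeGroup.isReduced_toWord hg).2
  have h2 := (key h.toWord FreeGroup.isReduced_toWord hh).1
  rw [FreeGroup.mk_toWord] at h1 h2
  exact h1.trans h2

/-- Elements of one component of the complement of a ball have the same initial segment. -/
theorem take_toWord_eq_of_mem_component {N : ℕ} {C : Set (FreeGroup B)}
    (hC : IsComponentOf B {g : FreeGroup B | g.norm ≤ N} C) {g h : FreeGroup B} (hg : g ∈ C)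
    (hh : h ∈ C) : g.toWord.take (N + 1) = h.toWord.take (N + 1) := by
  obtain ⟨v, -, rfl⟩ := hC
  have key : ∀ u, Relation.ReflTransGen (fun a b => Adj B a b ∧
      a ∉ {g : FreeGroup B | g.norm ≤ N} ∧ b ∉ {g : FreeGroup B | g.norm ≤ N}) v u →
      v.toWord.take (N + 1) = u.toWord.take (N + 1) := by
    intro u hu
    induction hu with
    | refl => rfl
    | tail _ hbc ih =>
      obtain ⟨⟨x, rfl⟩, hb, hc⟩ := hbc
      simp only [Set.mem_ofPred_eq, not_le, FreeGroup.norm] at hb hc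
      rw [ih]
      rcases toWord_mul_letter _ x with h | h
      · rw [h, List.take_append_of_le_length (by omega)]
      · rw [h, List.take_append_of_le_length (by omega)]
  exact (key g hg).symm.trans (key h hh)

theorem initialWord_eq_of_mem_boundaryOf {N : ℕ} {C : Set (FreeGroup B)}
    (hC : IsComponentOf B {g : FreeGroup B | g.norm ≤ N} C) {ξ η : Boundary B}
    (hξ : ξ ∈ boundaryOf B C) (hη : η ∈ boundaryOf B C) :
    initialWord ξ (N + 1) = initialWord η (N + 1) := by
  obtain ⟨m, hm⟩ := hξ
  obtain ⟨m', hm'⟩ := hη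
  have h := take_toWord_eq_of_mem_component hC (hm (max (max m m') (N + 1)) (by omega))
    (hm' (max (max m m') (N + 1)) (by omega))
  rwa [toWord_prefixOf, toWord_prefixOf, take_initialWord _ (by omega),
    take_initialWord _ (by omega)] at h

/-- Every boundary point lies in `∂C` for some component `C` of the complement of a ball, and
`∂C` contains the boundary points sharing its first `N + 1` letters. -/
theorem exists_component_mem_boundaryOf (N : ℕ) (ξ : Boundary B) :
    ∃ C, IsComponentOf B {g : FreeGroup B | g.norm ≤ N} C ∧
      ∀ η, initialWord η (N + 1) = initialWord ξ (N + 1) → η ∈ boundaryOf B C := by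
  have hout : ∀ (η : Boundary B) k, N + 1 ≤ k →
      prefixOf B η k ∉ {g : FreeGroup B | g.norm ≤ N} := by
    intro η k hk
    simp only [Set.mem_ofPred_eq, FreeGroup.norm, toWord_prefixOf, length_initialWord]
    omega
  refine ⟨_, ⟨prefixOf B ξ (N + 1), hout ξ _ le_rfl, rfl⟩, fun η hη => ⟨N + 1, fun k hk => ?_⟩⟩
  induction k, hk using Nat.le_induction with
  | base =>
    have : prefixOf B η (N + 1) = prefixOf B ξ (N + 1) := congrArg FreeGroup.mk hη
    rw [this]
    exact Relation.ReflTransGen.refl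
  | succ k hk ih =>
    refine Relation.ReflTransGen.tail ih ⟨⟨η.1 k, ?_⟩, hout η k hk, hout η _ (by omega)⟩
    change FreeGroup.mk (initialWord η (k + 1)) = FreeGroup.mk (initialWord η k) * _
    rw [initialWord_succ, FreeGroup.mul_mk]

end Tree

section Topology

variable {B : Type}

instance : DiscreteTopology (B × Bool) := ⟨rfl⟩

instance [Finite B] : CompactSpace (Boundary B) := by
  have hclosed : IsClosed {s : ℕ → B × Bool | ∀ k, s (k + 1) ≠ ((s k).1, !(s k).2)} := by
    rw [Set.ofPred_forall]
    refine isClosed_iInter fun k => ?_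
    have hcont : Continuous fun s : ℕ → B × Bool => (s k, s (k + 1)) := by fun_prop
    exact (isClosed_discrete {p : (B × Bool) × (B × Bool) |
      p.2 ≠ (p.1.1, !p.1.2)}).preimage hcont
  exact isCompact_iff_compactSpace.1 hclosed.isCompact

/-- The boundary points sharing their first `m` letters with `ξ`. -/
def cyl (ξ : Boundary B) (m : ℕ) : Set (Boundary B) :=
  {η | initialWord η m = initialWord ξ m}

theorem cyl_eq_preimage (ξ : Boundary B) (m : ℕ) :
    cyl ξ m = Subtype.val ⁻¹' PiNat.cylinder (E := fun _ => B × Bool) ξ.1 m := by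
  ext η
  simp only [cyl, Set.mem_ofPred_eq, initialWord_eq_iff, Set.mem_preimage,
    PiNat.mem_cylinder_iff]

theorem isOpen_cyl (ξ : Boundary B) (m : ℕ) : IsOpen (cyl ξ m) := by
  rw [cyl_eq_preimage]
  exact (PiNat.isOpen_cylinder (fun _ => B × Bool) ξ.1 m).preimage continuous_subtype_val

theorem self_mem_cyl (ξ : Boundary B) (m : ℕ) : ξ ∈ cyl ξ m := rfl

theorem cyl_anti (ξ : Boundary B) {m k : ℕ} (h : m ≤ k) : cyl ξ k ⊆ cyl ξ m := by
  intro η hη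
  have hη : initialWord η k = initialWord ξ k := hη
  change initialWord η m = initialWord ξ m
  rw [← take_initialWord η h, hη, take_initialWord ξ h]

theorem exists_cyl_subset {U : Set (Boundary B)} (hU : IsOpen U) {ξ : Boundary B}
    (hξ : ξ ∈ U) : ∃ m, cyl ξ m ⊆ U := by
  obtain ⟨V, hV, rfl⟩ := isOpen_induced_iff.1 hU
  obtain ⟨_, ⟨x, m, rfl⟩, hx, hsub⟩ :=
    (PiNat.isTopologicalBasis_cylinders (fun _ => B × Bool)).exists_subset_of_mem_open hξ hV
  refine ⟨m, ?_⟩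
  rw [cyl_eq_preimage, PiNat.mem_cylinder_iff_eq.1 hx]
  exact Set.preimage_mono hsub

/-- A Lebesgue number for open covers of the boundary. -/
theorem exists_uniform_cyl_subset [Finite B] (S : Set (Set (Boundary B)))
    (hS : ∀ V ∈ S, IsOpen V) (hcov : ⋃₀ S = Set.univ) :
    ∃ N, ∀ ξ : Boundary B, ∃ V ∈ S, cyl ξ N ⊆ V := by
  have hloc : ∀ ξ : Boundary B, ∃ m, ∃ V ∈ S, cyl ξ m ⊆ V := by
    intro ξ
    obtain ⟨V, hV, hξ⟩ := Set.mem_sUnion.1 (hcov ▸ Set.mem_univ ξ)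
    obtain ⟨m, hm⟩ := exists_cyl_subset (hS V hV) hξ
    exact ⟨m, V, hV, hm⟩
  choose m hm using hloc
  obtain ⟨t, ht⟩ := isCompact_univ.elim_finite_subcover (fun ξ : Boundary B => cyl ξ (m ξ))
    (fun ξ => isOpen_cyl ξ _) (fun ξ _ => Set.mem_iUnion.2 ⟨ξ, self_mem_cyl ξ _⟩)
  refine ⟨t.sup m, fun ξ => ?_⟩
  obtain ⟨ζ, hζ, hξ⟩ := Set.mem_iUnion₂.1 (ht (Set.mem_univ ξ))
  obtain ⟨V, hV, hsub⟩ := hm ζ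
  refine ⟨V, hV, fun η hη => hsub ?_⟩
  exact (cyl_anti ξ (Finset.le_sup hζ) hη).trans hξ

end Topology

section Quotient

variable {Y : Type*} {R : Y → Y → Prop}

/-- The points of the quotient by a symmetric relation that relates each point to at most one
other are single points or pairs of related points. -/
theorem quot_mk_eq_iff (hsymm : ∀ {x y}, R x y → R y x)
    (huniq : ∀ {x y z}, R x y → R x z → y = z) {x y : Y} :
    Quot.mk R x = Quot.mk R y ↔ x = y ∨ R x y := by
  refine ⟨fun h => ?_, ?_⟩
  · have hgen := Quot.eqvGen_exact h
    clear h
    induction hgen with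
    | rel x y h => exact Or.inr h
    | refl x => exact Or.inl rfl
    | symm x y _ ih => exact ih.imp Eq.symm hsymm
    | trans x y z _ _ ih₁ ih₂ =>
      rcases ih₁ with rfl | h₁
      · exact ih₂
      · rcases ih₂ with rfl | h₂
        · exact Or.inr h₁
        · exact Or.inl (huniq (hsymm h₁) h₂)
  · rintro (rfl | h)
    · rfl
    · exact Quot.sound h

variable [TopologicalSpace Y]

/-- The quotient map is closed if small neighbourhoods of each point are left by only finitely
many related pairs. -/
theorem isClosedMap_quot_mk [T1Space Y] (hsymm : ∀ {x y}, R x y → R y x)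
    (huniq : ∀ {x y z}, R x y → R x z → y = z)
    (hfin : ∀ x, ∀ U, IsOpen U → x ∈ U → ∃ V ⊆ U, IsOpen V ∧ x ∈ V ∧
      {y | y ∈ V ∧ ∃ z ∉ V, R y z}.Finite) :
    IsClosedMap (Quot.mk R) := by
  intro K hK
  rw [← isQuotientMap_quot_mk.isClosed_preimage, ← isOpen_compl_iff, isOpen_iff_mem_nhds]
  intro x hx
  have hxK : x ∉ K := fun h => hx ⟨x, h, rfl⟩
  obtain ⟨V, hVK, hV, hxV, hVfin⟩ := hfin x Kᶜ hK.isOpen_compl hxK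
  set E := {y | y ∈ V ∧ ∃ z ∈ K, R y z}
  have hE : E.Finite := hVfin.subset fun y ⟨hy, z, hz, hyz⟩ =>
    ⟨hy, z, fun hzV => hVK hzV hz, hyz⟩
  have hxE : x ∉ E := fun ⟨_, z, hz, hxz⟩ => hx ⟨z, hz, Quot.sound (hsymm hxz)⟩
  refine Filter.mem_of_superset ((hV.inter hE.isClosed.isOpen_compl).mem_nhds ⟨hxV, hxE⟩) ?_
  rintro y ⟨hyV, hyE⟩ ⟨z, hz, hzy⟩
  rcases (quot_mk_eq_iff hsymm huniq).1 hzy with rfl | h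
  · exact hVK hyV hz
  · exact hyE ⟨hyV, z, hz, hsymm h⟩

/-- A quotient of a normal `T₁` space by a closed quotient map is Hausdorff. -/
theorem t2Space_quot_of_isClosedMap [T1Space Y] [NormalSpace Y]
    (hq : IsClosedMap (Quot.mk R)) : T2Space (Quot R) := by
  have hcont : Continuous (Quot.mk R) := continuous_quot_mk
  have hclosed : ∀ d : Quot R, IsClosed (Quot.mk R ⁻¹' {d}) := by
    intro d
    obtain ⟨y, rfl⟩ := Quot.exists_rep d
    have := hq _ (isClosed_singleton (x := y))
    rw [Set.image_singleton] at this
    exact this.preimage hcont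
  refine ⟨fun d d' hne => ?_⟩
  obtain ⟨G, G', hG, hG', hdG, hdG', hdisj⟩ := normal_separation (hclosed d) (hclosed d')
    (Disjoint.preimage _ (Set.disjoint_singleton.2 hne))
  refine ⟨(Quot.mk R '' Gᶜ)ᶜ, (Quot.mk R '' G'ᶜ)ᶜ,
    (hq _ hG.isClosed_compl).isOpen_compl, (hq _ hG'.isClosed_compl).isOpen_compl,
    fun ⟨y, hy, hyd⟩ => hy (hdG hyd), fun ⟨y, hy, hyd⟩ => hy (hdG' hyd), ?_⟩
  rw [Set.disjoint_left]
  intro z hz hz'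
  obtain ⟨y, rfl⟩ := Quot.exists_rep z
  have h1 : y ∈ G := by_contra fun h => hz ⟨y, h, rfl⟩
  have h2 : y ∈ G' := by_contra fun h => hz' ⟨y, h, rfl⟩
  exact Set.disjoint_left.1 hdisj h1 h2

/-- Given an open partition `A` of `Y` refining a family of open sets `V` of the quotient and
such that only finitely many related pairs have their points in different pieces, the images of
the pieces have open neighbourhoods whose nerve is the graph recording those pairs. -/
theorem exists_open_cover_of_partition (hsymm : ∀ {x y}, R x y → R y x)
    (huniq : ∀ {x y z}, R x y → R x z → y = z) (hq : IsClosedMap (Quot.mk R))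
    [T2Space (Quot R)] {ι : Type*} (A : ι → Set Y) (hA : ∀ c, IsOpen (A c))
    (hdisj : ∀ {c c' y}, y ∈ A c → y ∈ A c' → c = c') (hcov : ∀ y, ∃ c, y ∈ A c)
    (hfin : {y | ∃ z c c', c ≠ c' ∧ y ∈ A c ∧ z ∈ A c' ∧ R y z}.Finite)
    (V : ι → Set (Quot R)) (hV : ∀ c, IsOpen (V c)) (hAV : ∀ c, Quot.mk R '' A c ⊆ V c) :
    ∃ U : ι → Set (Quot R), (∀ c, IsOpen (U c)) ∧ (⋃ c, U c) = Set.univ ∧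
      (∀ c, Quot.mk R '' A c ⊆ U c) ∧
      (∀ c c', c ≠ c' → ((U c ∩ U c').Nonempty ↔ ∃ y z, R y z ∧ y ∈ A c ∧ z ∈ A c')) ∧
      (∀ c c' c'', c ≠ c' → c' ≠ c'' → c ≠ c'' → U c ∩ U c' ∩ U c'' = ∅) ∧
      (∀ c, U c ⊆ V c) := by
  have hcont : Continuous (Quot.mk R) := continuous_quot_mk
  have heq {x y : Y} := quot_mk_eq_iff (R := R) hsymm huniq (x := x) (y := y)
  -- The pieces meeting the fibre over `d`, and the points with fibre meeting two pieces.
  let t : Quot R → Set ι := fun d => {c | d ∈ Quot.mk R '' A c}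
  let P : Set (Quot R) := {d | ∃ c c', c ≠ c' ∧ c ∈ t d ∧ c' ∈ t d}
  have hrel : ∀ {d c c'}, c ≠ c' → c ∈ t d → c' ∈ t d →
      ∃ y z, R y z ∧ y ∈ A c ∧ z ∈ A c' ∧ Quot.mk R y = d := by
    rintro d c c' hne ⟨y, hy, rfl⟩ ⟨z, hz, hzy⟩
    rcases heq.1 hzy.symm with rfl | h
    · exact absurd (hdisj hy hz) hne
    · exact ⟨y, z, h, hy, hz, rfl⟩
  have hP : P.Finite := by
    refine (hfin.image (Quot.mk R)).subset ?_
    rintro d ⟨c, c', hne, hc, hc'⟩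
    obtain ⟨y, z, hR, hy, hz, hyd⟩ := hrel hne hc hc'
    exact ⟨y, ⟨z, c, c', hne, hy, hz, hR⟩, hyd⟩
  have htwo : ∀ {d c c' c''}, c ≠ c' → c' ≠ c'' → c ≠ c'' → c ∈ t d → c' ∈ t d →
      c'' ∉ t d := by
    rintro d c c' c'' h₁ h₂ h₃ ⟨x, hx, rfl⟩ ⟨y, hy, hyx⟩ ⟨z, hz, hzx⟩
    rcases heq.1 hyx.symm with rfl | hxy
    · exact h₁ (hdisj hx hy)
    rcases heq.1 hzx.symm with rfl | hxz
    · exact h₃ (hdisj hx hz)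
    obtain rfl := huniq hxy hxz
    exact h₂ (hdisj hy hz)
  have htfin : ∀ d, (t d).Finite := by
    intro d
    by_contra hinf
    obtain ⟨c, hc⟩ := Set.Infinite.nonempty hinf
    obtain ⟨c', hc', hne⟩ := Set.Infinite.exists_notMem_finset hinf {c}
    obtain ⟨c'', hc'', hne'⟩ := Set.Infinite.exists_notMem_finset hinf
      ({c, c'} : Set ι).toFinite.toFinset
    simp only [Finset.mem_singleton, Set.Finite.mem_toFinset, Set.mem_insert_iff,
      Set.mem_singleton_iff, not_or] at hne hne'
    exact htwo (Ne.symm hne) (Ne.symm hne'.2) (Ne.symm hne'.1) hc hc' hc''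
  obtain ⟨S, hS, hSdisj⟩ := hP.t2_separation
  let O : Quot R → Set (Quot R) := fun d =>
    S d ∩ (⋂ c ∈ t d, V c) ∩ (Quot.mk R '' (⋃ c ∈ t d, A c)ᶜ)ᶜ
  have hOopen : ∀ d, IsOpen (O d) := fun d =>
    ((hS d).2.inter ((htfin d).isOpen_biInter fun c _ => hV c)).inter
      (hq _ (isOpen_biUnion fun c _ => hA c).isClosed_compl).isOpen_compl
  have hOmem : ∀ d, d ∈ O d := by
    refine fun d => ⟨⟨(hS d).1, Set.mem_iInter₂.2 fun c hc => hAV c hc⟩, ?_⟩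
    rintro ⟨y, hy, rfl⟩
    obtain ⟨c, hc⟩ := hcov y
    exact hy (Set.mem_biUnion (x := c) ⟨y, hc, rfl⟩ hc)
  have hOV : ∀ {d c}, c ∈ t d → O d ⊆ V c := fun hc x hx => Set.mem_iInter₂.1 hx.1.2 _ hc
  have hOt : ∀ {d y c}, Quot.mk R y ∈ O d → y ∈ A c → c ∈ t d := by
    intro d y c hy hyc
    by_contra hc
    refine hy.2 ⟨y, fun hmem => ?_, rfl⟩
    obtain ⟨c', hc', hyc'⟩ := Set.mem_iUnion₂.1 hmem
    exact hc (hdisj hyc hyc' ▸ hc')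
  have hOeq : ∀ {d d' x}, d ∈ P → d' ∈ P → x ∈ O d → x ∈ O d' → d = d' := by
    intro d d' x hd hd' hx hx'
    by_contra hne
    exact Set.disjoint_left.1 (hSdisj hd hd' hne) hx.1.1 hx'.1.1
  let U : ι → Set (Quot R) := fun c => Quot.mk R '' A c ∪ ⋃ d ∈ {d ∈ P | c ∈ t d}, O d
  have hU : ∀ {x c}, x ∈ U c → x ∈ Quot.mk R '' A c ∨ ∃ d ∈ P, c ∈ t d ∧ x ∈ O d := by
    rintro x c (hx | hx)
    · exact Or.inl hx
    · obtain ⟨d, ⟨hd, hc⟩, hx⟩ := Set.mem_iUnion₂.1 hx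
      exact Or.inr ⟨d, hd, hc, hx⟩
  have hmeet : ∀ {c c' x}, c ≠ c' → x ∈ U c → x ∈ U c' →
      ∃ d ∈ P, x ∈ O d ∧ c ∈ t d ∧ c' ∈ t d := by
    intro c c' x hne hx hx'
    rcases hU hx with hx | ⟨d, hd, hc, hxd⟩ <;> rcases hU hx' with hx' | ⟨d', hd', hc', hxd'⟩
    · exact ⟨x, ⟨c, c', hne, hx, hx'⟩, hOmem x, hx, hx'⟩
    · obtain ⟨y, hy, rfl⟩ := hx
      exact ⟨d', hd', hxd', hOt hxd' hy, hc'⟩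
    · obtain ⟨y, hy, rfl⟩ := hx'
      exact ⟨d, hd, hxd, hc, hOt hxd hy⟩
    · obtain rfl := hOeq hd hd' hxd hxd'
      exact ⟨d, hd, hxd, hc, hc'⟩
  refine ⟨U, fun c => ?_, ?_, fun c => Set.subset_union_left, fun c c' hne => ⟨?_, ?_⟩, ?_, ?_⟩
  · rw [← isQuotientMap_quot_mk.isOpen_preimage]
    have hpre : Quot.mk R ⁻¹' U c = A c ∪ ⋃ d ∈ {d ∈ P | c ∈ t d}, Quot.mk R ⁻¹' O d := by
      ext y
      constructor
      · intro hy
        rcases hU hy with hyc | ⟨d, hd, hc, hyd⟩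
        · obtain ⟨c', hc'⟩ := hcov y
          by_cases hcc : c = c'
          · exact Or.inl (hcc ▸ hc')
          · exact Or.inr (Set.mem_biUnion (x := Quot.mk R y)
              ⟨⟨c, c', hcc, hyc, ⟨y, hc', rfl⟩⟩, hyc⟩ (hOmem _))
        · exact Or.inr (Set.mem_biUnion (x := d) ⟨hd, hc⟩ hyd)
      · rintro (hy | hy)
        · exact Or.inl ⟨y, hy, rfl⟩
        · obtain ⟨d, hd, hyd⟩ := Set.mem_iUnion₂.1 hy
          exact Or.inr (Set.mem_biUnion (x := d) hd hyd)
    rw [hpre]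
    exact (hA c).union (isOpen_biUnion fun d _ => (hOopen d).preimage hcont)
  · rw [Set.eq_univ_iff_forall]
    intro d
    obtain ⟨y, rfl⟩ := Quot.exists_rep d
    obtain ⟨c, hc⟩ := hcov y
    exact Set.mem_iUnion.2 ⟨c, Or.inl ⟨y, hc, rfl⟩⟩
  · rintro ⟨x, hx, hx'⟩
    obtain ⟨d, -, -, hc, hc'⟩ := hmeet hne hx hx'
    obtain ⟨y, z, hR, hy, hz, -⟩ := hrel hne hc hc'
    exact ⟨y, z, hR, hy, hz⟩
  · rintro ⟨y, z, hR, hy, hz⟩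
    exact ⟨Quot.mk R y, Or.inl ⟨y, hy, rfl⟩, Or.inl ⟨z, hz, (Quot.sound hR).symm⟩⟩
  · intro c c' c'' h₁ h₂ h₃
    rw [Set.eq_empty_iff_forall_notMem]
    rintro x ⟨⟨hx, hx'⟩, hx''⟩
    obtain ⟨d, hd, hxd, hc, hc'⟩ := hmeet h₁ hx hx'
    obtain ⟨d', hd', hxd', -, hc''⟩ := hmeet h₃ hx hx''
    obtain rfl := hOeq hd hd' hxd hxd'
    exact htwo h₁ h₂ h₃ hc hc' hc''
  · intro c x hx
    rcases hU hx with hx | ⟨d, -, hc, hxd⟩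
    · exact hAV c hx
    · exact hOV hc hxd

end Quotient

end DecompPaper

open DecompPaper
/-- Lemma `refining`: every finite open cover `W` of `D` is refined
by a cover of the form given in Lemma `construction`, for some finite nonempty subtree
`X` of `T` containing `e`. -/
theorem decomposition_space_cover_refining
    (B : Type) [Fintype B] [DecidableEq B] (hB : 2 ≤ Fintype.card B)
    (r : ℕ) (w : Fin r → FreeGroup B) (hw : ∀ i, w i ≠ 1) (hmal : Malnormal B w)
    (W : Set (Set (DSpace B w))) (hWfin : W.Finite)
    (hWopen : ∀ V ∈ W, IsOpen V) (hWcov : ⋃₀ W = Set.univ) :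
    ∃ X : Set (FreeGroup B), X.Finite ∧ X.Nonempty ∧ IsSubtree B X ∧
      (1 : FreeGroup B) ∈ X ∧
      ∃ U : {C : Set (FreeGroup B) // IsComponentOf B X C} → Set (DSpace B w),
        (∀ C, IsOpen (U C)) ∧
        (⋃ C, U C) = Set.univ ∧
        (∀ C, qmap B w '' boundaryOf B C.1 ⊆ U C) ∧
        (∀ C C', C ≠ C' →
          ((U C ∩ U C').Nonempty ↔
            ∃ ξ η, IsLine B w ξ η ∧ ξ ∈ boundaryOf B C.1 ∧ η ∈ boundaryOf B C'.1)) ∧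
        (∀ C C' C'', C ≠ C' → C' ≠ C'' → C ≠ C'' → U C ∩ U C' ∩ U C'' = ∅) ∧
        (∀ C, ∃ V ∈ W, U C ⊆ V) := by
  have hsymm : ∀ {ξ η : Boundary B}, IsLine B w ξ η → IsLine B w η ξ := IsLine.symm
  have huniq : ∀ {ξ η ζ : Boundary B}, IsLine B w ξ η → IsLine B w ξ ζ → η = ζ :=
    IsLine.right_unique hw hmal
  have hq : IsClosedMap (Quot.mk (IsLine B w)) := by
    refine isClosedMap_quot_mk hsymm huniq fun ξ U hU hξ => ?_
    obtain ⟨m, hm⟩ := exists_cyl_subset hU hξ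
    refine ⟨cyl ξ m, hm, isOpen_cyl ξ m, self_mem_cyl ξ m,
      ((finite_lines_separated w m).image Prod.fst).subset ?_⟩
    rintro η ⟨hη, ζ, hζ, hline⟩
    exact ⟨(η, ζ), ⟨hline, fun h => hζ (h.symm.trans hη)⟩, rfl⟩
  have : T2Space (DSpace B w) := t2Space_quot_of_isClosedMap hq
  obtain ⟨N, hN⟩ := exists_uniform_cyl_subset ((fun V => qmap B w ⁻¹' V) '' W)
    (by
      rintro _ ⟨V, hV, rfl⟩
      exact (hWopen V hV).preimage continuous_quot_mk)
    (by
      rw [Set.sUnion_image, ← Set.preimage_iUnion₂, ← Set.sUnion_eq_biUnion, hWcov,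
        Set.preimage_univ])
  have hlebesgue : ∀ C : {C // IsComponentOf B {g : FreeGroup B | g.norm ≤ N} C},
      ∃ V ∈ W, qmap B w '' boundaryOf B C.1 ⊆ V := by
    rintro ⟨C, hC⟩
    rcases (boundaryOf B C).eq_empty_or_nonempty with h | ⟨ξ, hξ⟩
    · have : Nonempty B := Fintype.card_pos_iff.1 (by omega)
      obtain ⟨b⟩ := this
      let ξ : Boundary B := ⟨fun _ => (b, true), fun _ h => by simp at h⟩
      obtain ⟨V, hV, -⟩ := Set.mem_sUnion.1 (hWcov ▸ Set.mem_univ (qmap B w ξ))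
      exact ⟨V, hV, by simp [h]⟩
    · obtain ⟨_, ⟨V, hV, rfl⟩, hsub⟩ := hN ξ
      refine ⟨V, hV, Set.image_subset_iff.2 fun η hη => hsub (cyl_anti ξ N.le_succ ?_)⟩
      exact initialWord_eq_of_mem_boundaryOf hC hη hξ
  choose V hVW hV using hlebesgue
  refine ⟨{g | g.norm ≤ N}, finite_norm_le N, ⟨1, by simp⟩, isSubtree_ball N, by simp, ?_⟩
  obtain ⟨U, hUopen, hUcov, hAU, hUnerve, hUtriple, hUV⟩ :=
    exists_open_cover_of_partition hsymm huniq hq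
      (fun C : {C // IsComponentOf B {g : FreeGroup B | g.norm ≤ N} C} => boundaryOf B C.1)
      (by
        rintro ⟨C, hC⟩
        rw [isOpen_iff_mem_nhds]
        intro ξ hξ
        obtain ⟨C', hC', hmem⟩ := exists_component_mem_boundaryOf N ξ
        obtain rfl := eq_of_mem_boundaryOf hC hC' hξ (hmem ξ rfl)
        exact Filter.mem_of_superset ((isOpen_cyl ξ (N + 1)).mem_nhds rfl) hmem)
      (fun {C C' _} h h' => Subtype.ext (eq_of_mem_boundaryOf C.2 C'.2 h h'))
      (fun ξ => by
        obtain ⟨C, hC, hmem⟩ := exists_component_mem_boundaryOf N ξ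
        exact ⟨⟨C, hC⟩, hmem ξ rfl⟩)
      (by
        refine ((finite_lines_separated w (N + 1)).image Prod.fst).subset ?_
        rintro ξ ⟨η, C, C', hne, hξ, hη, hline⟩
        refine ⟨(ξ, η), ⟨hline, fun h => hne (Subtype.ext ?_)⟩, rfl⟩
        obtain ⟨C₀, hC₀, hmem⟩ := exists_component_mem_boundaryOf N ξ
        exact (eq_of_mem_boundaryOf C.2 hC₀ hξ (hmem ξ rfl)).trans
          (eq_of_mem_boundaryOf C'.2 hC₀ hη (hmem η h.symm)).symm)
      V (fun C => hWopen _ (hVW C)) hV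
  exact ⟨U, hUopen, hUcov, hAU, hUnerve, hUtriple, fun C => ⟨V C, hVW C, hUV C⟩⟩
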